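/- (Main theorem, formula (1.16)) For every natural number N and every x ∈ R: (−1)^N · Σ_{ℓ=0}^{N} [N,ℓ]_q · (−x)^ℓ = Σ_{k=0}^{⌊N/2⌋} [⌊N/2⌋,k]_{q²} · (∏_{i=0}^{N−2k−1} (x − q^i)) · (∏_{j=0}^{k−1} (1 − q^{N−ε(N)−2j})), where ε(N) = 1 if N is even and ε(N) = 0 if N is odd. (All exponents N−ε(N)−2j occurring are nonnegative.) -/

import Mathlib

/-- The Gaussian (`q`-binomial) coefficient `[n, k]_q`, defined by the recurrence
`[n, 0]_q = 1`, `[0, k+1]_q = 0`, `[n+1, k+1]_q = [n, k]_q + q^(k+1) * [n, k+1]_q`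
(so that `[n+1, k]_q = [n, k-1]_q + q^k * [n, k]_q` and `[n, k]_q = 0` for `k > n`). -/
def qBinom {R : Type*} [CommRing R] (q : R) : ℕ → ℕ → R
  | _, 0 => 1
  | 0, _ + 1 => 0
  | n + 1, k + 1 => qBinom q n k + q ^ (k + 1) * qBinom q n (k + 1)

section QBinom

variable {R : Type*} [CommRing R] (q : R)

theorem qBinom_zero_right (n : ℕ) : qBinom q n 0 = 1 := by
  cases n <;> simp [qBinom]

theorem qBinom_succ_succ (n k : ℕ) :
    qBinom q (n + 1) (k + 1) = qBinom q n k + q ^ (k + 1) * qBinom q n (k + 1) := by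
  simp [qBinom]

theorem qBinom_eq_zero_of_lt {n k : ℕ} (h : n < k) : qBinom q n k = 0 := by
  induction n generalizing k with
  | zero =>
    obtain ⟨k, rfl⟩ : ∃ j, k = j + 1 := ⟨k - 1, by omega⟩
    simp [qBinom]
  | succ n ih =>
    obtain ⟨k, rfl⟩ : ∃ j, k = j + 1 := ⟨k - 1, by omega⟩
    rw [qBinom_succ_succ, ih (by omega), ih (by omega)]
    simp

/-- The ratio of horizontally adjacent Gaussian coefficients, in division-free form. -/
theorem one_sub_pow_mul_qBinom_right (n k : ℕ) :
    (1 - q ^ (n - k)) * qBinom q n k = (1 - q ^ (k + 1)) * qBinom q n (k + 1) := by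
  induction n generalizing k with
  | zero => simp [qBinom]
  | succ n ih =>
    rcases Nat.lt_or_ge n k with h | h
    · rw [qBinom_eq_zero_of_lt q (show n + 1 < k + 1 by omega), show n + 1 - k = 0 by omega]
      simp
    obtain ⟨d, rfl⟩ := Nat.exists_eq_add_of_le h
    have h₁ := ih k
    rw [show k + d - k = d by omega] at h₁
    rw [show k + d + 1 - k = d + 1 by omega, qBinom_succ_succ]
    cases k with
    | zero =>
      rw [qBinom_zero_right] at h₁ ⊢
      rw [qBinom_zero_right]
      simp only [zero_add, pow_succ] at h₁ ⊢
      linear_combination q * h₁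
    | succ k =>
      have h₂ := ih k
      rw [show k + 1 + d - k = d + 1 by omega] at h₂
      rw [qBinom_succ_succ]
      linear_combination h₂ + q ^ (k + 1 + 1) * h₁

theorem qBinom_succ_succ' (n k : ℕ) :
    qBinom q (n + 1) (k + 1) = qBinom q n (k + 1) + q ^ (n - k) * qBinom q n k := by
  rw [qBinom_succ_succ]
  linear_combination one_sub_pow_mul_qBinom_right q n k

theorem one_sub_pow_mul_qBinom_succ_succ (n k : ℕ) :
    (1 - q ^ (k + 1)) * qBinom q (n + 1) (k + 1) = (1 - q ^ (n + 1)) * qBinom q n k := by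
  rcases Nat.lt_or_ge n k with h | h
  · simp [qBinom_eq_zero_of_lt q h, qBinom_eq_zero_of_lt q (show n + 1 < k + 1 by omega)]
  obtain ⟨d, rfl⟩ := Nat.exists_eq_add_of_le h
  have h₁ := one_sub_pow_mul_qBinom_right q (k + d) k
  rw [show k + d - k = d by omega] at h₁
  rw [qBinom_succ_succ]
  linear_combination -q ^ (k + 1) * h₁

theorem one_sub_pow_mul_qBinom_succ (n k : ℕ) :
    (1 - q ^ (n + 1 - k)) * qBinom q (n + 1) k = (1 - q ^ (n + 1)) * qBinom q n k := by
  rw [one_sub_pow_mul_qBinom_right, one_sub_pow_mul_qBinom_succ_succ]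

/-- The three-term recurrence of the Rogers–Szegő polynomials. -/
theorem sum_qBinom_mul_pow_add_two (n : ℕ) (t : R) :
    ∑ l ∈ Finset.range (n + 3), qBinom q (n + 2) l * t ^ l =
      (1 + t) * ∑ l ∈ Finset.range (n + 2), qBinom q (n + 1) l * t ^ l
        - (1 - q ^ (n + 1)) * t * ∑ l ∈ Finset.range (n + 1), qBinom q n l * t ^ l := by
  have h₁ : ∑ l ∈ Finset.range (n + 2), qBinom q (n + 1) l * t ^ l =
      1 + ∑ l ∈ Finset.range (n + 2), qBinom q (n + 1) (l + 1) * t ^ (l + 1) := by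
    have h := Finset.sum_range_succ (fun l => qBinom q (n + 1) l * t ^ l) (n + 2)
    rw [Finset.sum_range_succ', qBinom_eq_zero_of_lt q (show n + 1 < n + 2 by omega),
      qBinom_zero_right] at h
    linear_combination -h
  have h₂ : ∑ l ∈ Finset.range (n + 1), qBinom q n l * t ^ l =
      ∑ l ∈ Finset.range (n + 2), qBinom q n l * t ^ l := by
    rw [Finset.sum_range_succ _ (n + 1), qBinom_eq_zero_of_lt q (show n < n + 1 by omega)]
    simp
  rw [h₂, add_mul, one_mul]
  nth_rewrite 1 [h₁]
  rw [Finset.sum_range_succ', qBinom_zero_right, Finset.mul_sum, Finset.mul_sum, add_assoc,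
    ← Finset.sum_add_distrib, add_sub_assoc, ← Finset.sum_sub_distrib, pow_zero, mul_one, add_comm]
  congr 1
  refine Finset.sum_congr rfl fun l _ => ?_
  rw [qBinom_succ_succ q (n + 1) l]
  linear_combination -t ^ (l + 1) * one_sub_pow_mul_qBinom_succ_succ q n l

/-- The coefficient of `∏_{i < N - 2k} (x - q^i)` in the expansion of the `N`-th Gauss
polynomial. -/
def gaussCoeff (N k : ℕ) : R :=
  qBinom (q ^ 2) (N / 2) k *
    ∏ j ∈ Finset.range k, (1 - q ^ (N - (if Even N then 1 else 0) - 2 * j))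

theorem gaussCoeff_zero_right (N : ℕ) : gaussCoeff q N 0 = 1 := by
  simp [gaussCoeff, qBinom_zero_right]

theorem gaussCoeff_eq_zero_of_lt {N k : ℕ} (h : N < 2 * k) : gaussCoeff q N k = 0 := by
  simp [gaussCoeff, qBinom_eq_zero_of_lt (q ^ 2) (show N / 2 < k by omega)]

theorem gaussCoeff_even (m k : ℕ) :
    gaussCoeff q (2 * m) k =
      qBinom (q ^ 2) m k * ∏ j ∈ Finset.range k, (1 - q ^ (2 * m - 1 - 2 * j)) := by
  simp [gaussCoeff]

theorem gaussCoeff_odd (m k : ℕ) :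
    gaussCoeff q (2 * m + 1) k =
      qBinom (q ^ 2) m k * ∏ j ∈ Finset.range k, (1 - q ^ (2 * m + 1 - 2 * j)) := by
  rw [gaussCoeff, if_neg (by simp), show (2 * m + 1) / 2 = m by omega, Nat.sub_zero]

theorem gaussCoeff_even_succ (m k : ℕ) :
    gaussCoeff q (2 * m + 2) k =
      qBinom (q ^ 2) (m + 1) k * ∏ j ∈ Finset.range k, (1 - q ^ (2 * m + 1 - 2 * j)) :=
  gaussCoeff_even q (m + 1) k

theorem prod_one_sub_pow_succ (a k : ℕ) :
    ∏ j ∈ Finset.range (k + 1), (1 - q ^ (a - 2 * j)) =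
      (1 - q ^ a) * ∏ j ∈ Finset.range k, (1 - q ^ (a - 2 - 2 * j)) := by
  rw [Finset.prod_range_succ', mul_comm]
  congr 1
  refine Finset.prod_congr rfl fun j _ => ?_
  rw [show a - 2 * (j + 1) = a - 2 - 2 * j by omega]

theorem one_sub_pow_mul_gaussCoeff_succ (N k : ℕ) :
    (1 - q ^ (N + 1 - 2 * k)) * gaussCoeff q (N + 1) k =
      (1 - q ^ (N + 1)) * gaussCoeff q N k := by
  obtain ⟨m, rfl | rfl⟩ := Nat.even_or_odd' N
  · have h := prod_one_sub_pow_succ q (2 * m + 1) k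
    rw [Finset.prod_range_succ, show 2 * m + 1 - 2 = 2 * m - 1 by omega] at h
    rw [gaussCoeff_odd, gaussCoeff_even]
    linear_combination qBinom (q ^ 2) m k * h
  · have h := one_sub_pow_mul_qBinom_succ (q ^ 2) m k
    rw [← pow_mul, ← pow_mul, show 2 * (m + 1 - k) = 2 * m + 1 + 1 - 2 * k by omega,
      show 2 * (m + 1) = 2 * m + 1 + 1 by omega] at h
    rw [gaussCoeff_odd, gaussCoeff_even_succ, ← mul_assoc, h, mul_assoc]

theorem gaussCoeff_add_two_succ (N k : ℕ) :
    gaussCoeff q (N + 2) (k + 1) =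
      gaussCoeff q (N + 1) (k + 1) +
        (1 - q ^ (N + 1)) * q ^ (N - 2 * k) * gaussCoeff q N k := by
  rcases Nat.lt_or_ge N (2 * k) with hk | hk
  · simp [gaussCoeff_eq_zero_of_lt q hk,
      gaussCoeff_eq_zero_of_lt q (show N + 1 < 2 * (k + 1) by omega),
      gaussCoeff_eq_zero_of_lt q (show N + 2 < 2 * (k + 1) by omega)]
  obtain ⟨m, rfl | rfl⟩ := Nat.even_or_odd' N
  · have h := qBinom_succ_succ' (q ^ 2) m k
    rw [← pow_mul, Nat.mul_sub] at h
    rw [gaussCoeff_even_succ, gaussCoeff_odd, gaussCoeff_even, prod_one_sub_pow_succ,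
      show 2 * m + 1 - 2 = 2 * m - 1 by omega, h]
    ring
  · obtain ⟨d, rfl⟩ := Nat.exists_eq_add_of_le (show k ≤ m by omega)
    have h := one_sub_pow_mul_qBinom_succ_succ (q ^ 2) (k + d) k
    rw [← pow_mul, ← pow_mul] at h
    rw [show 2 * (k + d) + 1 + 2 = 2 * (k + d + 1) + 1 by omega, gaussCoeff_odd,
      show 2 * (k + d) + 1 + 1 = 2 * (k + d) + 2 by omega, gaussCoeff_even_succ, gaussCoeff_odd,
      prod_one_sub_pow_succ, show 2 * (k + d + 1) + 1 - 2 = 2 * (k + d) + 1 by omega,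
      Finset.prod_range_succ, show 2 * (k + d) + 1 - 2 * k = 2 * d + 1 by omega]
    linear_combination
      q ^ (2 * d + 1) * (∏ j ∈ Finset.range k, (1 - q ^ (2 * (k + d) + 1 - 2 * j))) * h

theorem sum_gaussCoeff_add_two {N M : ℕ} (hM : N < 2 * M) (x : R) :
    ∑ k ∈ Finset.range (M + 1),
        gaussCoeff q (N + 2) k * ∏ i ∈ Finset.range (N + 2 - 2 * k), (x - q ^ i) =
      (x - 1) * ∑ k ∈ Finset.range (M + 1),
        gaussCoeff q (N + 1) k * ∏ i ∈ Finset.range (N + 1 - 2 * k), (x - q ^ i) +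
      (1 - q ^ (N + 1)) * x * ∑ k ∈ Finset.range (M + 1),
        gaussCoeff q N k * ∏ i ∈ Finset.range (N - 2 * k), (x - q ^ i) := by
  have h (k : ℕ) :
      (x - 1) * (gaussCoeff q (N + 1) k * ∏ i ∈ Finset.range (N + 1 - 2 * k), (x - q ^ i)) +
        (1 - q ^ (N + 1)) * x *
          (gaussCoeff q N k * ∏ i ∈ Finset.range (N - 2 * k), (x - q ^ i)) =
      gaussCoeff q (N + 1) k * (∏ i ∈ Finset.range (N + 2 - 2 * k), (x - q ^ i)) +
        (1 - q ^ (N + 1)) * q ^ (N - 2 * k) * gaussCoeff q N k *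
          ∏ i ∈ Finset.range (N - 2 * k), (x - q ^ i) := by
    have h₁ := one_sub_pow_mul_gaussCoeff_succ q N k
    rcases Nat.lt_or_ge N (2 * k) with hk | hk
    · rw [gaussCoeff_eq_zero_of_lt q hk] at h₁ ⊢
      rcases Nat.lt_or_ge (N + 1) (2 * k) with hk' | hk'
      · simp [gaussCoeff_eq_zero_of_lt q hk']
      · rw [show N + 2 - 2 * k = 1 by omega, show N + 1 - 2 * k = 0 by omega]
        simp [mul_comm]
    · obtain ⟨d, rfl⟩ := Nat.exists_eq_add_of_le hk
      rw [show 2 * k + d + 1 - 2 * k = d + 1 by omega] at h₁ ⊢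
      rw [show 2 * k + d + 2 - 2 * k = d + 1 + 1 by omega,
        show 2 * k + d - 2 * k = d by omega, Finset.prod_range_succ _ (d + 1),
        Finset.prod_range_succ _ d]
      linear_combination -(∏ i ∈ Finset.range d, (x - q ^ i)) * (x - q ^ d) * h₁
  rw [Finset.mul_sum, Finset.mul_sum, ← Finset.sum_add_distrib, Finset.sum_congr rfl fun k _ => h k,
    Finset.sum_add_distrib, Finset.sum_range_succ' _ M, Finset.sum_range_succ' _ M,
    Finset.sum_range_succ _ M, gaussCoeff_eq_zero_of_lt q hM, gaussCoeff_zero_right,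
    gaussCoeff_zero_right, mul_zero (_ * _), zero_mul, add_zero, add_right_comm,
    ← Finset.sum_add_distrib]
  congr 1
  refine Finset.sum_congr rfl fun k _ => ?_
  rw [gaussCoeff_add_two_succ, show N + 2 - 2 * (k + 1) = N - 2 * k by omega]
  ring

theorem sum_gaussCoeff_of_lt {N M : ℕ} (hM : N < 2 * M) (x : R) :
    ∑ k ∈ Finset.range M, gaussCoeff q N k * ∏ i ∈ Finset.range (N - 2 * k), (x - q ^ i) =
      (-1) ^ N * ∑ l ∈ Finset.range (N + 1), qBinom q N l * (-x) ^ l := by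
  induction N using Nat.twoStepInduction generalizing M with
  | zero =>
    obtain ⟨M, rfl⟩ : ∃ j, M = j + 1 := ⟨M - 1, by omega⟩
    rw [Finset.sum_range_succ', Finset.sum_eq_zero fun k _ => by
      rw [gaussCoeff_eq_zero_of_lt q (by omega), zero_mul]]
    simp [gaussCoeff_zero_right, qBinom_zero_right]
  | one =>
    obtain ⟨M, rfl⟩ : ∃ j, M = j + 1 := ⟨M - 1, by omega⟩
    rw [Finset.sum_range_succ', Finset.sum_eq_zero fun k _ => by
      rw [gaussCoeff_eq_zero_of_lt q (by omega), zero_mul]]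
    simp [gaussCoeff_zero_right, Finset.sum_range_succ, qBinom]
    ring
  | more N ih₀ ih₁ =>
    obtain ⟨M, rfl⟩ : ∃ j, M = j + 1 := ⟨M - 1, by omega⟩
    rw [sum_gaussCoeff_add_two q (by omega), ih₀ (by omega), ih₁ (by omega),
      sum_qBinom_mul_pow_add_two]
    ring

end QBinom

/-- Formula (1.16): for all `N` and `x`,
`(-1)^N ∑_{ℓ=0}^{N} [N,ℓ]_q (-x)^ℓ
  = ∑_{k=0}^{⌊N/2⌋} [⌊N/2⌋,k]_{q²} (x ∸ 1)^{N-2k} (q^{N-ε(N)}; q^{-2})_k`,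
where `ε(N) = 1` if `N` is even and `0` if `N` is odd. -/
theorem gauss_main_formula {R : Type*} [CommRing R] (q : R) (N : ℕ) (x : R) :
    (-1) ^ N * ∑ ℓ ∈ Finset.range (N + 1), qBinom q N ℓ * (-x) ^ ℓ =
      ∑ k ∈ Finset.range (N / 2 + 1),
        qBinom (q ^ 2) (N / 2) k *
          (∏ i ∈ Finset.range (N - 2 * k), (x - q ^ i)) *
          (∏ j ∈ Finset.range k, (1 - q ^ (N - (if Even N then 1 else 0) - 2 * j))) := by
  rw [← sum_gaussCoeff_of_lt q (show N < 2 * (N / 2 + 1) by omega)]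
  exact Finset.sum_congr rfl fun k _ => mul_right_comm _ _ _
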